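/- Let n ≥ 2 be an integer, P_n = ⟨a_0, …, a_k⟩ the n-th P-sequence, p a nonzero integer and l an integer. Define U_{p,l} = {p·i + l : 0 ≤ i ≤ k, a_i = -1} and V_{p,l} = {p·i + l : 0 ≤ i ≤ k, a_i = 1}. Then U_{p,l} and V_{p,l} are disjoint finite subsets of ℤ of equal cardinality, ∑_{u∈U_{p,l}} u^s = ∑_{v∈V_{p,l}} v^s for every s = 0, …, n-1, and ∑_{u∈U_{p,l}} u^n ≠ ∑_{v∈V_{p,l}} v^n; that is, ⟨U_{p,l}, V_{p,l}⟩ is a Prouhet-Tarry-Escott pair for n. -/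

import Mathlib

/-- One step of the recursive construction of P-sequences. -/
def Pnext (a : List ℤ) : List ℤ :=
  if a.getLast! = -a.head! then a ++ a.reverse
  else a.dropLast ++ [0] ++ (a.dropLast.reverse.map (fun x => -x))

/-- `Pseq (n-1)` is the `n`-th P-sequence `P_n` (so `Pseq 0 = P_1 = ⟨1,-1⟩`). -/
def Pseq : ℕ → List ℤ
  | 0 => [1, -1]
  | n + 1 => Pnext (Pseq n)

/-- The sum of `f` over the positions of a list, weighted by its entries. -/
def weightedSum (a : List ℤ) (f : ℕ → ℤ) : ℤ :=
  ∑ i ∈ Finset.range a.length, a.getD i 0 * f i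

theorem weightedSum_nil (f : ℕ → ℤ) : weightedSum [] f = 0 := by
  simp [weightedSum]

theorem weightedSum_cons (x : ℤ) (a : List ℤ) (f : ℕ → ℤ) :
    weightedSum (x :: a) f = x * f 0 + weightedSum a (fun i => f (i + 1)) := by
  simp [weightedSum, Finset.sum_range_succ', add_comm]

theorem weightedSum_append (a b : List ℤ) (f : ℕ → ℤ) :
    weightedSum (a ++ b) f = weightedSum a f + weightedSum b (fun i => f (i + a.length)) := by
  induction a generalizing f with
  | nil => simp [weightedSum_nil]
  | cons x a ih =>
    simp only [List.cons_append, weightedSum_cons, ih, List.length_cons]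
    simp only [add_assoc]

theorem weightedSum_map_neg (a : List ℤ) (f : ℕ → ℤ) :
    weightedSum (a.map (fun x => -x)) f = -weightedSum a f := by
  induction a generalizing f with
  | nil => simp [weightedSum_nil]
  | cons x a ih => simp only [List.map_cons, weightedSum_cons, ih]; ring

theorem weightedSum_sub (a : List ℤ) (f g : ℕ → ℤ) :
    weightedSum a (fun i => f i - g i) = weightedSum a f - weightedSum a g := by
  simp [weightedSum, mul_sub]

/-- Lists with entries in `{-1, 0, 1}` and first entry `1` that are symmetric or antisymmetric
under reversal. -/
def IsSignedPalindrome (a : List ℤ) : Prop :=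
  (∀ x ∈ a, x = -1 ∨ x = 0 ∨ x = 1) ∧ ∃ u : List ℤ,
    (a = 1 :: (u ++ [1]) ∧ u.reverse = u) ∨
      (a = 1 :: (u ++ [-1]) ∧ u.reverse = u.map (fun x => -x))

theorem Pnext_symmetric (u : List ℤ) (hu : u.reverse = u) :
    Pnext (1 :: (u ++ [1])) = 1 :: (u ++ 0 :: (u.map (fun x => -x) ++ [-1])) := by
  have h : (1 :: (u ++ [1])).dropLast = 1 :: u := List.dropLast_concat (l₁ := 1 :: u)
  rw [Pnext, if_neg (by simp [List.getLast!_eq_getLast?_getD, List.getLast?_cons]), h]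
  simp [hu]

theorem Pnext_antisymmetric (u : List ℤ) (hu : u.reverse = u.map (fun x => -x)) :
    Pnext (1 :: (u ++ [-1])) = 1 :: (u ++ -1 :: -1 :: (u.map (fun x => -x) ++ [1])) := by
  rw [Pnext, if_pos (by simp [List.getLast!_eq_getLast?_getD, List.getLast?_cons])]
  simp [hu]

theorem IsSignedPalindrome.next {a : List ℤ} (ha : IsSignedPalindrome a) :
    IsSignedPalindrome (Pnext a) := by
  obtain ⟨he, u, ⟨rfl, hu⟩ | ⟨rfl, hu⟩⟩ := ha
  · have hu' : ∀ x ∈ u, x = -1 ∨ x = 0 ∨ x = 1 := fun x hx => he x (by simp [hx])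
    rw [Pnext_symmetric u hu]
    refine ⟨?_, u ++ 0 :: u.map (fun x => -x), Or.inr ⟨by simp, ?_⟩⟩
    · intro x hx
      simp only [List.mem_cons, List.mem_append, List.mem_map, List.not_mem_nil, or_false] at hx
      rcases hx with rfl | h | rfl | ⟨y, hy, rfl⟩ | rfl
      · simp
      · exact hu' x h
      · simp
      · rcases hu' y hy with rfl | rfl | rfl <;> simp
      · simp
    · simp [← List.map_reverse, hu]
  · have hu' : ∀ x ∈ u, x = -1 ∨ x = 0 ∨ x = 1 := fun x hx => he x (by simp [hx])
    rw [Pnext_antisymmetric u hu]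
    refine ⟨?_, u ++ -1 :: -1 :: u.map (fun x => -x), Or.inl ⟨by simp, ?_⟩⟩
    · intro x hx
      simp only [List.mem_cons, List.mem_append, List.mem_map, List.not_mem_nil, or_false] at hx
      rcases hx with rfl | h | rfl | rfl | ⟨y, hy, rfl⟩ | rfl
      · simp
      · exact hu' x h
      · simp
      · simp
      · rcases hu' y hy with rfl | rfl | rfl <;> simp
      · simp
    · simp [← List.map_reverse, hu]

/-- Passing from one P-sequence to the next multiplies its generating polynomial by some
`1 - X ^ m` with `m ≠ 0`. -/
theorem IsSignedPalindrome.exists_weightedSum_Pnext {a : List ℤ} (ha : IsSignedPalindrome a) :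
    ∃ m : ℕ, m ≠ 0 ∧ ∀ f : ℕ → ℤ,
      weightedSum (Pnext a) f = weightedSum a (fun i => f i - f (i + m)) := by
  obtain ⟨-, u, ⟨rfl, hu⟩ | ⟨rfl, hu⟩⟩ := ha
  · refine ⟨u.length + 1, by simp, fun f => ?_⟩
    rw [Pnext_symmetric u hu, weightedSum_sub]
    simp only [weightedSum_cons, weightedSum_append, weightedSum_map_neg, weightedSum_nil,
      List.length_map]
    ring_nf
  · refine ⟨u.length + 2, by simp, fun f => ?_⟩
    rw [Pnext_antisymmetric u hu, weightedSum_sub]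
    simp only [weightedSum_cons, weightedSum_append, weightedSum_map_neg, weightedSum_nil,
      List.length_map]
    ring_nf

theorem isSignedPalindrome_Pseq (n : ℕ) : IsSignedPalindrome (Pseq n) := by
  induction n with
  | zero => exact ⟨by simp [Pseq], [], Or.inr (by simp [Pseq])⟩
  | succ n ih => exact ih.next

open Polynomial in
theorem Polynomial.coeff_taylor_of_natDegree_le_succ {R : Type*} [CommSemiring R] {q : R[X]}
    {n : ℕ} (hq : q.natDegree ≤ n + 1) (r : R) :
    (taylor r q).coeff n = q.coeff n + (n + 1) * q.coeff (n + 1) * r := by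
  have hd : (hasseDeriv n q).natDegree < 2 := by
    have := natDegree_hasseDeriv_le q n
    omega
  rw [taylor_coeff, eval_eq_sum_range' hd]
  simp [Finset.sum_range_succ, hasseDeriv_coeff, add_comm 1 n]

open Polynomial in
theorem Polynomial.natDegree_sub_taylor_le {R : Type*} [CommRing R] {q : R[X]} {n : ℕ}
    (hq : q.natDegree ≤ n + 1) (r : R) : (q - taylor r q).natDegree ≤ n := by
  rw [natDegree_le_iff_coeff_eq_zero]
  intro N hN
  rw [coeff_sub, coeff_taylor_of_natDegree_le_succ (by omega),
    coeff_eq_zero_of_natDegree_lt (p := q) (n := N + 1) (by omega)]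
  simp

/-- The functional attached to `P_{n+1}` extracts a nonzero multiple of the coefficient of
`X ^ (n + 1)` from polynomials of degree at most `n + 1`. -/
theorem exists_weightedSum_Pseq_eval (n : ℕ) :
    ∃ c : ℤ, c ≠ 0 ∧ ∀ q : Polynomial ℤ, q.natDegree ≤ n + 1 →
      weightedSum (Pseq n) (fun i => q.eval (i : ℤ)) = c * q.coeff (n + 1) := by
  induction n with
  | zero =>
    refine ⟨-1, by simp, fun q hq => ?_⟩
    have hd : q.natDegree < 2 := by omega
    simp only [Pseq, weightedSum_cons, weightedSum_nil, Polynomial.eval_eq_sum_range' hd]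
    simp [Finset.sum_range_succ]
  | succ n ih =>
    obtain ⟨c, hc, h⟩ := ih
    obtain ⟨m, hm, hw⟩ := (isSignedPalindrome_Pseq n).exists_weightedSum_Pnext
    refine ⟨-(c * (n + 2) * m), ?_, fun q hq => ?_⟩
    · have : (n : ℤ) + 2 ≠ 0 := by positivity
      simp [hc, hm, this]
    · have hs := h (q - Polynomial.taylor (m : ℤ) q) (Polynomial.natDegree_sub_taylor_le hq _)
      rw [Polynomial.coeff_sub, Polynomial.coeff_taylor_of_natDegree_le_succ hq] at hs
      simp only [Polynomial.eval_sub, Polynomial.taylor_eval] at hs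
      rw [Pseq, hw]
      push_cast at hs ⊢
      rw [hs]
      ring

theorem weightedSum_eq_sum_sub_sum {a : List ℤ} (ha : ∀ x ∈ a, x = -1 ∨ x = 0 ∨ x = 1)
    (f : ℕ → ℤ) :
    weightedSum a f = ∑ i ∈ Finset.range a.length with a.getD i 0 = 1, f i -
      ∑ i ∈ Finset.range a.length with a.getD i 0 = -1, f i := by
  rw [weightedSum, Finset.sum_filter, Finset.sum_filter, ← Finset.sum_sub_distrib]
  refine Finset.sum_congr rfl fun i hi => ?_
  have hi := Finset.mem_range.mp hi
  have hx : a.getD i 0 ∈ a := by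
    rw [List.getD_eq_getElem _ _ hi]
    exact List.getElem_mem hi
  rcases ha _ hx with h | h | h <;> rw [h] <;> simp

/-- for `n ≥ 2`, `P_n = ⟨a_0,…,a_k⟩`, `p ≠ 0` and `l` integers, the
sets `U_{p,l} = {pi+l : a_i = -1}` and `V_{p,l} = {pi+l : a_i = 1}` form a
Prouhet-Tarry-Escott pair for `n`: they are disjoint, have the same cardinality,
`∑_{u∈U} u^s = ∑_{v∈V} v^s` for `s = 0,…,n-1`, and `∑_{u∈U} u^n ≠ ∑_{v∈V} v^n`. -/
theorem Pseq_ProuhetTarryEscott (n : ℕ) (hn : 2 ≤ n) (p l : ℤ) (hp : p ≠ 0) :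
    let a := Pseq (n - 1)
    let U : Finset ℤ :=
      ((Finset.range a.length).filter (fun i => a.getD i 0 = -1)).image
        (fun i : ℕ => p * (i : ℤ) + l)
    let V : Finset ℤ :=
      ((Finset.range a.length).filter (fun i => a.getD i 0 = 1)).image
        (fun i : ℕ => p * (i : ℤ) + l)
    Disjoint U V ∧ U.card = V.card ∧
      (∀ s : ℕ, s < n → ∑ u ∈ U, u ^ s = ∑ v ∈ V, v ^ s) ∧
      ∑ u ∈ U, u ^ n ≠ ∑ v ∈ V, v ^ n := by
  intro a U V
  have hinj : Function.Injective (fun i : ℕ => p * (i : ℤ) + l) := fun i j h => by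
    simpa [hp] using h
  obtain ⟨c, hc, h⟩ := exists_weightedSum_Pseq_eval (n - 1)
  rw [Nat.sub_add_cancel (by omega)] at h
  have hsum (s : ℕ) (hs : s ≤ n) :
      ∑ v ∈ V, v ^ s - ∑ u ∈ U, u ^ s =
        c * ((Polynomial.C p * Polynomial.X + Polynomial.C l) ^ s).coeff n := by
    have hd := Polynomial.natDegree_pow_le_of_le s
      (Polynomial.natDegree_linear_le (a := p) (b := l))
    rw [← h _ (by omega), weightedSum_eq_sum_sub_sum (isSignedPalindrome_Pseq (n - 1)).1,
      Finset.sum_image hinj.injOn, Finset.sum_image hinj.injOn]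
    simp [a]
  have hlt (s : ℕ) (hs : s < n) : ∑ u ∈ U, u ^ s = ∑ v ∈ V, v ^ s := by
    have hd := Polynomial.natDegree_pow_le_of_le s
      (Polynomial.natDegree_linear_le (a := p) (b := l))
    have := hsum s hs.le
    rw [Polynomial.coeff_eq_zero_of_natDegree_lt (by omega), mul_zero] at this
    exact (sub_eq_zero.mp this).symm
  refine ⟨?_, by simpa using hlt 0 (by omega), hlt, fun he => ?_⟩
  · rw [Finset.disjoint_image hinj]
    exact Finset.disjoint_filter.mpr fun i _ h₁ h₂ => by omega
  · have := hsum n le_rfl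
    have hcoeff := Polynomial.coeff_pow_of_natDegree_le (m := n)
      (Polynomial.natDegree_linear_le (a := p) (b := l))
    simp only [mul_one] at hcoeff
    have hp' : (Polynomial.C p * Polynomial.X + Polynomial.C l).coeff 1 = p := by
      rw [Polynomial.coeff_add, Polynomial.coeff_C_mul_X, Polynomial.coeff_C]
      simp
    rw [he, sub_self, hcoeff, hp'] at this
    exact mul_ne_zero hc (pow_ne_zero n hp) this.symm
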